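/- arXiv:1304.7558 — 6 statements merged into one kernel-verified Lean document; each statement's English description precedes it below -/
import Mathlib

section
/- Let k ≥ 2, n ≥ 1 and let x : Fin (k+1) → ℤ → ℤ give k+1 lists, the relevant entries being x i b for b ∈ {1, …, n}. Then there exist b₁, …, b_{k+1} ∈ {1, …, n} with b_{k+1} = b₁ + ⋯ + b_k and ∑_{i=1}^{k+1} x_i(b_i) = 0 (a solution of the CONVOLUTION-(k+1)-SUM instance) if and only if there exist integers a₁ < a₂ < ⋯ < a_k all lying in {1, …, n} such that x₁(a₁) + ∑_{i=2}^{k} x_i(a_i − a_{i−1}) + x_{k+1}(a_k) = 0. (The latter expression is exactly the total weight of the P_k-subgraph (a₁,…,a_k) under the path edge weights w(v_{1,r}, v_{2,s}) = x₁(r) + x₂(s−r), w(v_{i,r}, v_{i+1,s}) = x_{i+1}(s−r) for the middle edges, and w(v_{k−1,r}, v_{k,s}) = x_k(s−r) + x_{k+1}(s).) -/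
theorem Fin.sum_univ_succ_sub_castSucc {G : Type*} [AddCommGroup G] {m : ℕ} (a : Fin (m + 1) → G) :
    ∑ j : Fin m, (a j.succ - a j.castSucc) = a (Fin.last m) - a 0 := by
  induction m with
  | zero => simp
  | succ m ih =>
    have h := ih fun j => a j.castSucc
    simp only [← Fin.succ_castSucc, Fin.castSucc_zero] at h
    rw [Fin.sum_univ_castSucc, h, Fin.succ_last]
    abel

/-- If the first `m + 1` entries of `b` are the initial value and the increments of `a`, and the
last entry of `b` is the final value of `a`, then `b` has the same weight as the path `a`. -/
theorem sum_eq_path_weight {m : ℕ} (x : Fin (m + 1 + 1) → ℤ → ℤ) (a : Fin (m + 1) → ℤ)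
    (b : Fin (m + 1 + 1) → ℤ) (h0 : b 0 = a 0)
    (hstep : ∀ j : Fin m, b j.succ.castSucc = a j.succ - a j.castSucc)
    (hlast : b (Fin.last (m + 1)) = a (Fin.last m)) :
    ∑ i, x i (b i) =
      x 0 (a 0) +
        (∑ j : Fin (m + 1), if 1 ≤ j.val then
          x j.castSucc (a j - a ⟨j.val - 1, by have := j.isLt; omega⟩) else 0) +
        x (Fin.last (m + 1)) (a (Fin.last m)) := by
  rw [Fin.sum_univ_castSucc, hlast, Fin.sum_univ_succ, Fin.sum_univ_succ, Fin.castSucc_zero, h0]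
  have key (j : Fin m) : x j.succ.castSucc (b j.succ.castSucc) =
      if 1 ≤ j.succ.val then
        x j.succ.castSucc (a j.succ - a ⟨j.succ.val - 1, by have := j.succ.isLt; omega⟩) else 0 := by
    rw [if_pos (by simp), hstep]
    rfl
  simp only [key]
  simp

/- CONVOLUTION-(k+1)-SUM versus the exact-weight k-path expression.
Lists are `x i : ℤ → ℤ` for `i : Fin (k+1)` (0-based; `x ⟨i-1,_⟩` is the i-th list
`x_i` of the paper), the relevant entries being `x i b` for `b ∈ {1, …, n}`. -/
theorem stmt_3 (k n : ℕ) (hk : 2 ≤ k) (hn : 1 ≤ n) (x : Fin (k + 1) → ℤ → ℤ) :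
    (∃ b : Fin (k + 1) → ℤ, (∀ i, 1 ≤ b i ∧ b i ≤ (n : ℤ)) ∧
        b (Fin.last k) = (∑ i : Fin k, b i.castSucc) ∧
        (∑ i, x i (b i)) = 0) ↔
      (∃ a : Fin k → ℤ, StrictMono a ∧ (∀ i, 1 ≤ a i ∧ a i ≤ (n : ℤ)) ∧
        x 0 (a ⟨0, by omega⟩) +
          (∑ j : Fin k, if 1 ≤ j.val then
              x j.castSucc (a j - a ⟨j.val - 1, by have := j.isLt; omega⟩) else 0) +
          x (Fin.last k) (a ⟨k - 1, by omega⟩) = 0) := by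
  obtain ⟨m, rfl⟩ : ∃ m, k = m + 1 := ⟨k - 1, by omega⟩
  constructor
  · rintro ⟨b, hb, hsum, hx⟩
    set a : Fin (m + 1) → ℤ := fun j => ∑ i ∈ Finset.Iic j, b i.castSucc with ha
    have h0 : b 0 = a 0 := by
      have : Finset.Iic (0 : Fin (m + 1)) = {0} := by ext i; simp
      simp [ha, this]
    have hlast : b (Fin.last (m + 1)) = a (Fin.last m) := by
      have : Finset.Iic (Fin.last m) = Finset.univ := by ext i; simp [Fin.le_last]
      simp [ha, this, hsum]
    have hstep (j : Fin m) : b j.succ.castSucc = a j.succ - a j.castSucc := by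
      have : Finset.Iic j.succ = insert j.succ (Finset.Iic j.castSucc) := by
        ext i
        simp only [Finset.mem_Iic, Finset.mem_insert, Fin.le_def, Fin.ext_iff, Fin.val_succ,
          Fin.val_castSucc]
        omega
      simp only [ha]
      rw [this, Finset.sum_insert (by simp [Fin.le_def])]
      ring
    have hmono : StrictMono a := Fin.strictMono_iff_lt_succ.2 fun j => by
      have := hstep j
      have := (hb j.succ.castSucc).1
      omega
    refine ⟨a, hmono, fun i => ⟨?_, ?_⟩, (sum_eq_path_weight x a b h0 hstep hlast).symm.trans hx⟩
    · exact (h0 ▸ (hb 0).1).trans (hmono.monotone (Fin.zero_le i))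
    · exact (hmono.monotone (Fin.le_last i)).trans (hlast ▸ (hb (Fin.last (m + 1))).2)
  · rintro ⟨a, hmono, ha, hx⟩
    set c : Fin (m + 1) → ℤ := Fin.cons (a 0) fun j => a j.succ - a j.castSucc with hc
    set b : Fin (m + 1 + 1) → ℤ := Fin.snoc c (a (Fin.last m)) with hb
    have hcast (i : Fin (m + 1)) : b i.castSucc = c i := by
      rw [hb, Fin.snoc_castSucc (α := fun _ => ℤ)]
    have h0 : b 0 = a 0 := by rw [← Fin.castSucc_zero, hcast]; simp [hc]
    have hstep (j : Fin m) : b j.succ.castSucc = a j.succ - a j.castSucc := by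
      rw [hcast]; simp [hc]
    have hlast : b (Fin.last (m + 1)) = a (Fin.last m) := by
      rw [hb, Fin.snoc_last (α := fun _ => ℤ)]
    refine ⟨b, fun i => ?_, ?_, (sum_eq_path_weight x a b h0 hstep hlast).trans hx⟩
    · induction i using Fin.lastCases with
      | last => exact hlast ▸ ha _
      | cast i =>
        induction i using Fin.cases with
        | zero => rw [Fin.castSucc_zero, h0]; exact ha 0
        | succ j =>
          rw [hstep]
          have := hmono (Fin.castSucc_lt_succ (i := j))
          have := ha j.succ
          have := ha j.castSucc
          omega
    · rw [hlast, Fin.sum_univ_succ, Fin.castSucc_zero, h0]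
      simp only [hstep, Fin.sum_univ_succ_sub_castSucc]
      ring
end

section
/- Let H' be a simple graph on Fin (k+1) and let p ≠ q be two vertices of H' that are non-adjacent and have no common neighbor. Let f : Fin (k+1) → Fin k be the surjection identifying q with p and injective on the remaining vertices, and let H be the contracted graph on Fin k in which i and j are adjacent iff i ≠ j and some preimages of i and j under f are adjacent in H'; note |E(H)| = |E(H')| =: d. Suppose the complete H-partite graph G with parts of size n has node weights wV and edge weights wE all of absolute value at most W, and let K be an integer with K > (d + k + 1)·W. Define weights for the complete H'-partite graph G' as follows: each super-edge {i', j'} of H' carries the same edge weights as the super-edge {f i', f j'} of G; parts of G' other than p and q carry the node weights of the corresponding parts of G; the vertex indexed a ∈ Fin n of part p has node weight wV (f p) a + a·K; and the vertex indexed a of part q has node weight −a·K. Then: (i) in every H'-subgraph of G' of total weight 0, the indices chosen in parts p and q coincide; and (ii) G has an H-subgraph of total weight 0 if and only if G' has an H'-subgraph of total weight 0. -/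
/- Total weight of an H-subgraph in a weighted complete H-partite graph:
node weights plus edge weights, each unordered edge {i,j} (i < j) counted once. -/
open scoped Classical in
noncomputable def totalWeight {k n : ℕ} (H : SimpleGraph (Fin k))
    (wV : Fin k → Fin n → ℤ) (wE : Fin k → Fin k → Fin n → Fin n → ℤ)
    (a : Fin k → Fin n) : ℤ :=
  (∑ i, wV i (a i)) +
    ∑ i, ∑ j, if i < j ∧ H.Adj i j then wE i j (a i) (a j) else 0

open scoped Classical in
/-- The edge part of `totalWeight` is a sum over the edge set when the edge weights are symmetric. -/
theorem totalWeight_eq_sum_edgeFinset {k n : ℕ} (H : SimpleGraph (Fin k))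
    (wV : Fin k → Fin n → ℤ) (wE : Fin k → Fin k → Fin n → Fin n → ℤ)
    (hsymm : ∀ i j a b, wE i j a b = wE j i b a) (a : Fin k → Fin n) :
    totalWeight H wV wE a = (∑ i, wV i (a i)) +
      ∑ e ∈ H.edgeFinset,
        Sym2.lift ⟨fun i j => wE i j (a i) (a j), fun i j => hsymm i j (a i) (a j)⟩ e := by
  unfold totalWeight
  congr 1
  rw [← Finset.sum_product', ← Finset.sum_filter]
  refine Finset.sum_bij (fun x _ => s(x.1, x.2)) ?_ ?_ ?_ ?_
  · rintro ⟨i, j⟩ h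
    simpa using (Finset.mem_filter.mp h).2.2
  · rintro ⟨i, j⟩ h ⟨i', j'⟩ h' he
    have h1 := (Finset.mem_filter.mp h).2.1
    have h2 := (Finset.mem_filter.mp h').2.1
    rcases Sym2.eq_iff.mp he with ⟨rfl, rfl⟩ | ⟨rfl, rfl⟩
    · rfl
    · exact absurd h1 (lt_asymm h2)
  · intro e he
    induction e using Sym2.ind with
    | _ i j =>
      have hij : H.Adj i j := by simpa using he
      rcases lt_or_gt_of_ne hij.ne with h | h
      · exact ⟨(i, j), by simp [h, hij], rfl⟩
      · exact ⟨(j, i), by simp [h, hij.symm], Sym2.eq_swap⟩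
  · rintro ⟨i, j⟩ _
    rfl

open scoped Classical in
/-- If `H` is the image of `H'` under a map that separates adjacent vertices and both graphs have
equally many edges, then summing over the edges of `H` is summing over the edges of `H'`. -/
theorem sum_edgeFinset_map {V V' M : Type*} [Fintype V] [Fintype V'] [AddCommMonoid M]
    (H : SimpleGraph V) (H' : SimpleGraph V') (f : V' → V)
    (hH : ∀ i j, H.Adj i j ↔ i ≠ j ∧ ∃ i' j', f i' = i ∧ f j' = j ∧ H'.Adj i' j')
    (hne : ∀ i' j', H'.Adj i' j' → f i' ≠ f j')
    (hcard : H'.edgeFinset.card = H.edgeFinset.card) (g : Sym2 V → M) :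
    ∑ e ∈ H'.edgeFinset, g (e.map f) = ∑ e ∈ H.edgeFinset, g e := by
  have himage : H'.edgeFinset.image (Sym2.map f) = H.edgeFinset := by
    ext e
    induction e using Sym2.ind with
    | _ i j =>
      simp only [Finset.mem_image, SimpleGraph.mem_edgeFinset, SimpleGraph.mem_edgeSet]
      constructor
      · rintro ⟨e, he, hij⟩
        induction e using Sym2.ind with
        | _ i' j' =>
          have hadj : H'.Adj i' j' := he
          have : H.Adj (f i') (f j') := (hH _ _).mpr ⟨hne _ _ hadj, i', j', rfl, rfl, hadj⟩
          rw [← SimpleGraph.mem_edgeSet, ← hij]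
          exact this
      · intro h
        obtain ⟨-, i', j', rfl, rfl, hadj⟩ := (hH i j).mp h
        exact ⟨s(i', j'), hadj, rfl⟩
  rw [← himage, Finset.sum_image]
  exact Finset.card_image_iff.mp (by rw [himage, hcard])

open scoped Classical in
/- Contraction of two non-adjacent vertices `p ≠ q` with no common neighbour:
`f` identifies `q` with `p` and is injective elsewhere, `H` is the contracted graph,
`d = |E(H)| = |E(H')|`, and the weights of `G'` are obtained from those of `G` as in
the paper (`p`-part node weights shifted by `+a·K`, `q`-part node weights set to `−a·K`). -/
theorem stmt_5 (k n : ℕ) (hk : 1 ≤ k) (hn : 1 ≤ n)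
    (H' : SimpleGraph (Fin (k + 1))) (p q : Fin (k + 1)) (hpq : p ≠ q)
    (hnadj : ¬ H'.Adj p q) (hnocommon : ∀ z, ¬ (H'.Adj p z ∧ H'.Adj q z))
    (f : Fin (k + 1) → Fin k) (hfsurj : Function.Surjective f) (hfq : f q = f p)
    (hfinj : ∀ i j, i ≠ q → j ≠ q → f i = f j → i = j)
    (H : SimpleGraph (Fin k))
    (hH : ∀ i j, H.Adj i j ↔ i ≠ j ∧ ∃ i' j', f i' = i ∧ f j' = j ∧ H'.Adj i' j')
    (d : ℕ) (hd : d = H.edgeFinset.card) (hd' : d = H'.edgeFinset.card)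
    (wV : Fin k → Fin n → ℤ) (wE : Fin k → Fin k → Fin n → Fin n → ℤ)
    (hsymm : ∀ i j a b, wE i j a b = wE j i b a)
    (W : ℤ) (hWV : ∀ i a, |wV i a| ≤ W) (hWE : ∀ i j a b, |wE i j a b| ≤ W)
    (K : ℤ) (hK : ((d : ℤ) + (k : ℤ) + 1) * W < K)
    (wE' : Fin (k + 1) → Fin (k + 1) → Fin n → Fin n → ℤ)
    (hwE' : ∀ i' j' a b, wE' i' j' a b = wE (f i') (f j') a b)
    (wV' : Fin (k + 1) → Fin n → ℤ)
    (hwV'p : ∀ a : Fin n, wV' p a = wV (f p) a + (a.val : ℤ) * K)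
    (hwV'q : ∀ a : Fin n, wV' q a = -((a.val : ℤ) * K))
    (hwV'other : ∀ i', i' ≠ p → i' ≠ q → ∀ a : Fin n, wV' i' a = wV (f i') a) :
    (∀ a' : Fin (k + 1) → Fin n, totalWeight H' wV' wE' a' = 0 → a' p = a' q) ∧
    ((∃ a : Fin k → Fin n, totalWeight H wV wE a = 0) ↔
      ∃ a' : Fin (k + 1) → Fin n, totalWeight H' wV' wE' a' = 0) := by
  have hW : 0 ≤ W := (abs_nonneg _).trans (hWV ⟨0, hk⟩ ⟨0, hn⟩)
  have hsymm' : ∀ i j a b, wE' i j a b = wE' j i b a := fun i j a b => by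
    rw [hwE', hwE', hsymm]
  have hne : ∀ i j, H'.Adj i j → f i ≠ f j := by
    intro i j hadj hij
    by_cases hi : i = q
    · subst hi
      have hj : p = j := hfinj p j hpq hadj.ne' (hfq.symm.trans hij)
      exact hnadj (hj ▸ hadj.symm)
    · by_cases hj : j = q
      · subst hj
        have hi' : i = p := hfinj i p hi hpq (hij.trans hfq)
        exact hnadj (hi' ▸ hadj)
      · exact hadj.ne (hfinj i j hi hj hij)
  have hnode : ∀ a' : Fin (k + 1) → Fin n, ∑ i, wV' i (a' i) =
      ∑ i ∈ Finset.univ.erase q, wV (f i) (a' i) + ((a' p).val - (a' q).val : ℤ) * K := by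
    intro a'
    have hp : p ∈ Finset.univ.erase q := by simp [hpq]
    rw [← Finset.add_sum_erase _ _ (Finset.mem_univ q), ← Finset.add_sum_erase _ _ hp,
      ← Finset.add_sum_erase _ (fun i => wV (f i) (a' i)) hp, hwV'p, hwV'q,
      Finset.sum_congr rfl fun i hi => hwV'other i (by simp_all) (by simp_all) (a' i)]
    ring
  have hcoincide : ∀ a' : Fin (k + 1) → Fin n, totalWeight H' wV' wE' a' = 0 → a' p = a' q := by
    intro a' h0
    rw [totalWeight_eq_sum_edgeFinset _ _ _ hsymm', hnode] at h0
    have hnodeBound : |∑ i ∈ Finset.univ.erase q, wV (f i) (a' i)| ≤ k * W := by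
      refine (Finset.abs_sum_le_sum_abs _ _).trans
        ((Finset.sum_le_card_nsmul _ _ W fun i _ => hWV _ _).trans_eq ?_)
      simp
    have hedgeBound : |∑ e ∈ H'.edgeFinset, Sym2.lift ⟨fun i j => wE' i j (a' i) (a' j),
        fun i j => hsymm' i j (a' i) (a' j)⟩ e| ≤ d * W := by
      refine (Finset.abs_sum_le_sum_abs _ _).trans
        ((Finset.sum_le_card_nsmul _ _ W fun e _ => ?_).trans_eq ?_)
      · induction e using Sym2.ind with
        | _ i j => simpa only [Sym2.lift_mk, hwE'] using hWE _ _ _ _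
      · rw [hd', nsmul_eq_mul]
    rw [abs_le] at hnodeBound hedgeBound
    have hval : ((a' p).val : ℤ) = (a' q).val := by
      rcases lt_trichotomy ((a' p).val : ℤ) (a' q).val with h | h | h
      · nlinarith
      · exact h
      · nlinarith
    exact Fin.ext (by exact_mod_cast hval)
  have hlift : ∀ a : Fin k → Fin n,
      totalWeight H' wV' wE' (a ∘ f) = totalWeight H wV wE a := by
    intro a
    rw [totalWeight_eq_sum_edgeFinset _ _ _ hsymm', totalWeight_eq_sum_edgeFinset _ _ _ hsymm,
      hnode, ← sum_edgeFinset_map H H' f hH hne (hd'.symm.trans hd)]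
    congr 1
    · simp only [Function.comp_apply, hfq, sub_self, zero_mul, add_zero]
      refine Finset.sum_bij (fun i _ => f i) (by simp) ?_ ?_ (by simp)
      · intro i hi j hj hij
        exact hfinj i j (Finset.ne_of_mem_erase hi) (Finset.ne_of_mem_erase hj) hij
      · intro i _
        obtain ⟨i', rfl⟩ := hfsurj i
        by_cases h : i' = q
        · exact ⟨p, by simp [hpq], by rw [h, hfq]⟩
        · exact ⟨i', by simp [h], rfl⟩
    · refine Finset.sum_congr rfl fun e _ => ?_
      induction e using Sym2.ind with
      | _ i j => simp [hwE']
  refine ⟨hcoincide, fun ⟨a, ha⟩ => ⟨a ∘ f, (hlift a).trans ha⟩, fun ⟨a', ha'⟩ => ?_⟩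
  have hfactor : Function.FactorsThrough a' f := by
    intro i j hij
    have hpq' := hcoincide a' ha'
    by_cases hi : i = q <;> by_cases hj : j = q
    · rw [hi, hj]
    · rw [hi, ← hpq', hfinj p j hpq hj (by rw [← hij, hi, hfq])]
    · rw [hj, ← hpq', hfinj i p hi hpq (by rw [hij, hj, hfq])]
    · rw [hfinj i j hi hj hij]
  refine ⟨Function.extend f a' fun _ => ⟨0, hn⟩, ?_⟩
  rw [← hlift, hfactor.extend_comp]
  exact ha'
end

section
/- Let k, n ≥ 1, let H' be a simple graph on Fin k, and let H be the graph on Fin (k+1) whose restriction to Fin k is H' and in which the vertex k is adjacent to every vertex of Fin k. Let the complete H-partite graph G with parts of size n have node weights wV and edge weights wE. For each c ∈ Fin n define a complete H'-partite graph G'_c whose edge weights on the edges of H' are those of G and whose node weights are wV'_c i a = wV i a + wE {i, k} a c for 1 ≤ i ≤ k−1 and wV'_c 0 a = wV 0 a + wE {0, k} a c + wV k c. Then for every a : Fin k → Fin n, the total weight of the H'-subgraph a in G'_c equals the total weight in G of the H-subgraph that extends a by choosing index c in part k. Consequently, G has an H-subgraph of total weight 0 if and only if there exists c ∈ Fin n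 such that G'_c has an H'-subgraph of total weight 0. -/
/- `H` on `Fin (k+1)` restricts to `H'` on `Fin k` (via `Fin.castSucc`) and its last
vertex is adjacent to every other vertex.  For each choice `c` of a vertex in the last
part, `G'_c` is the complete `H'`-partite graph with edge weights inherited from `G` and
node weights absorbing the edges to the last part (vertex `0`'s weight also absorbs the
node weight of the chosen center `c`).  `Fin.snoc a c` extends `a` by choosing `c` in
part `k`. -/
theorem stmt_6 (k n : ℕ) (hk : 1 ≤ k) (hn : 1 ≤ n)
    (H' : SimpleGraph (Fin k)) (H : SimpleGraph (Fin (k + 1)))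
    (hrestrict : ∀ i j : Fin k, H.Adj i.castSucc j.castSucc ↔ H'.Adj i j)
    (hlast : ∀ i : Fin k, H.Adj i.castSucc (Fin.last k))
    (wV : Fin (k + 1) → Fin n → ℤ)
    (wE : Fin (k + 1) → Fin (k + 1) → Fin n → Fin n → ℤ)
    (wV' : Fin n → Fin k → Fin n → ℤ)
    (hwV' : ∀ (c : Fin n) (i : Fin k) (a : Fin n),
      wV' c i a = wV i.castSucc a + wE i.castSucc (Fin.last k) a c +
        (if i.val = 0 then wV (Fin.last k) c else 0))
    (wE' : Fin k → Fin k → Fin n → Fin n → ℤ)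
    (hwE' : ∀ (i j : Fin k) (a b : Fin n), wE' i j a b = wE i.castSucc j.castSucc a b) :
    (∀ (c : Fin n) (a : Fin k → Fin n),
        totalWeight H' (wV' c) wE' a = totalWeight H wV wE (Fin.snoc a c)) ∧
    ((∃ a' : Fin (k + 1) → Fin n, totalWeight H wV wE a' = 0) ↔
      ∃ (c : Fin n) (a : Fin k → Fin n), totalWeight H' (wV' c) wE' a = 0) := by
  have weight_snoc : ∀ (c : Fin n) (a : Fin k → Fin n),
      totalWeight H' (wV' c) wE' a = totalWeight H wV wE (Fin.snoc a c) := by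
    classical
    intro c a
    have sum_center : (∑ i : Fin k, if i.val = 0 then wV (Fin.last k) c else 0) =
        wV (Fin.last k) c := by
      rw [Finset.sum_eq_single_of_mem (⟨0, hk⟩ : Fin k) (Finset.mem_univ _)]
      · simp
      · intro i _ hi
        exact if_neg fun h => hi (Fin.ext h)
    have sum_edges : (∑ i : Fin k, ∑ j : Fin k,
          if i.castSucc < j.castSucc ∧ H.Adj i.castSucc j.castSucc then
            wE i.castSucc j.castSucc (a i) (a j) else 0) =
        ∑ i, ∑ j, if i < j ∧ H'.Adj i j then wE i.castSucc j.castSucc (a i) (a j) else 0 := by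
      refine Finset.sum_congr rfl fun i _ => Finset.sum_congr rfl fun j _ => ?_
      exact if_congr (and_congr Fin.castSucc_lt_castSucc_iff (hrestrict i j)) rfl rfl
    have not_last_lt : ∀ j : Fin (k + 1), ¬ Fin.last k < j := fun j => (Fin.le_last j).not_gt
    simp only [totalWeight, Fin.sum_univ_castSucc, Fin.snoc_castSucc, Fin.snoc_last, hwV', hwE',
      hlast, Fin.castSucc_lt_last, not_last_lt,
      false_and, and_self, if_true, if_false, Finset.sum_add_distrib, Finset.sum_const_zero,
      sum_center]
    rw [sum_edges]
    ring
  refine ⟨weight_snoc, ?_, ?_⟩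
  · rintro ⟨a', h⟩
    refine ⟨a' (Fin.last k), Fin.init a', ?_⟩
    rw [weight_snoc, Fin.snoc_init_self, h]
  · rintro ⟨c, a, h⟩
    exact ⟨Fin.snoc a c, by rw [← weight_snoc, h]⟩
end

section
/- Let H be a simple graph on Fin k with node weights wV and edge weights wE for the complete H-partite graph with parts of size n, and let (S, T₁, …, T_d) be a d-separator of H: the sets S, T₁, …, T_d partition Fin k and no edge of H joins a vertex of T_i to a vertex of T_j for distinct i, j. Then for every assignment a : Fin k → Fin n, ∑_{j=1}^{d} w_{T_j ∪ S}(a) = w(a) + (d − 1)·w_S(a), where w denotes the total weight and w_U the U-restricted weight. -/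
/- The U-restricted weight of the assignment `a` in a weighted complete H-partite graph:
node weights of parts in `U` plus the weights of edges `{i,j}` of `H` (each unordered
edge counted once, with `i < j`) with both endpoints in `U`.  The total weight is the
`Finset.univ`-restricted weight. -/
open scoped Classical in
noncomputable def restrictedWeight {k n : ℕ} (H : SimpleGraph (Fin k))
    (wV : Fin k → Fin n → ℤ) (wE : Fin k → Fin k → Fin n → Fin n → ℤ)
    (U : Finset (Fin k)) (a : Fin k → Fin n) : ℤ :=
  (∑ i ∈ U, wV i (a i)) +
    ∑ i, ∑ j, if i < j ∧ H.Adj i j ∧ i ∈ U ∧ j ∈ U then wE i j (a i) (a j) else 0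

open scoped Classical in
/-- If every `P j` and `R` follow from `Q`, and otherwise `R` holds exactly when a unique `P j`
does, then the indicators satisfy the inclusion-exclusion identity. -/
theorem sum_ite_eq_ite_add_mul_ite {d : ℕ} (P : Fin d → Prop) (Q R : Prop) (x : ℤ)
    (hall : Q → R ∧ ∀ j, P j) (hex : ¬ Q → (R ↔ ∃ j, P j))
    (huniq : ¬ Q → ∀ i j, P i → P j → i = j) :
    (∑ j, if P j then x else 0) =
      (if R then x else 0) + ((d : ℤ) - 1) * (if Q then x else 0) := by
  by_cases hQ : Q
  · obtain ⟨hR, hP⟩ := hall hQ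
    simp only [hQ, hR, hP, if_true, Finset.sum_const, Finset.card_univ, Fintype.card_fin,
      nsmul_eq_mul]
    ring
  by_cases hR : R
  · obtain ⟨j, hj⟩ := (hex hQ).1 hR
    rw [Finset.sum_eq_single j (fun i _ hij => if_neg fun hi => hij (huniq hQ i j hi hj))
      (by simp)]
    simp [hQ, hR, hj]
  · have hP : ∀ j, ¬ P j := fun j hj => hR ((hex hQ).2 ⟨j, hj⟩)
    simp [hQ, hR, hP]

/- `(S, T 1, …, T d)` is a d-separator: the sets partition `Fin k` and no edge of `H`
joins `T i` to `T j` for `i ≠ j`.  Then for every assignment `a`,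
`∑ j, w_{T j ∪ S}(a) = w(a) + (d − 1)·w_S(a)`. -/
theorem stmt_7 (k n d : ℕ) (hk : 1 ≤ k) (hn : 1 ≤ n) (hd : 1 ≤ d)
    (H : SimpleGraph (Fin k))
    (wV : Fin k → Fin n → ℤ) (wE : Fin k → Fin k → Fin n → Fin n → ℤ)
    (S : Finset (Fin k)) (T : Fin d → Finset (Fin k))
    (hTT : ∀ i j : Fin d, i ≠ j → Disjoint (T i) (T j))
    (hST : ∀ j : Fin d, Disjoint S (T j))
    (hcover : S ∪ Finset.univ.biUnion T = Finset.univ)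
    (hsep : ∀ i j : Fin d, i ≠ j → ∀ u ∈ T i, ∀ v ∈ T j, ¬ H.Adj u v) :
    ∀ a : Fin k → Fin n,
      (∑ j : Fin d, restrictedWeight H wV wE (T j ∪ S) a) =
        restrictedWeight H wV wE Finset.univ a +
          ((d : ℤ) - 1) * restrictedWeight H wV wE S a := by
  classical
  intro a
  have hmem : ∀ v, v ∉ S → ∃ j, v ∈ T j := fun v hv => by
    have h : v ∈ S ∪ Finset.univ.biUnion T := hcover ▸ Finset.mem_univ v
    simpa [hv] using h
  have huniq : ∀ v i j, v ∈ T i → v ∈ T j → i = j := fun v i j hi hj => by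
    by_contra hij
    exact Finset.disjoint_left.1 (hTT i j hij) hi hj
  have hnode : (∑ j : Fin d, ∑ v ∈ T j ∪ S, wV v (a v)) =
      (∑ v, wV v (a v)) + ((d : ℤ) - 1) * ∑ v ∈ S, wV v (a v) := by
    have hite : ∀ U : Finset (Fin k),
        ∑ v ∈ U, wV v (a v) = ∑ v, if v ∈ U then wV v (a v) else 0 := fun U => by simp
    rw [← Finset.sum_congr rfl fun j _ => (hite (T j ∪ S)).symm, hite Finset.univ, hite S,
      Finset.sum_comm, Finset.mul_sum, ← Finset.sum_add_distrib]
    refine Finset.sum_congr rfl fun v _ => ?_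
    convert sum_ite_eq_ite_add_mul_ite (fun j => v ∈ T j ∪ S) (v ∈ S) (v ∈ Finset.univ)
      (wV v (a v)) ?_ ?_ ?_
    · intro h
      simp [h]
    · intro h
      simpa [h] using hmem v h
    · intro h i j
      simpa [h] using huniq v i j
  have hedge : (∑ j : Fin d, ∑ u, ∑ v,
        if u < v ∧ H.Adj u v ∧ u ∈ T j ∪ S ∧ v ∈ T j ∪ S then wE u v (a u) (a v) else 0) =
      (∑ u, ∑ v, if u < v ∧ H.Adj u v ∧ u ∈ Finset.univ ∧ v ∈ Finset.univ
        then wE u v (a u) (a v) else 0) +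
      ((d : ℤ) - 1) * ∑ u, ∑ v, if u < v ∧ H.Adj u v ∧ u ∈ S ∧ v ∈ S
        then wE u v (a u) (a v) else 0 := by
    rw [Finset.sum_comm, Finset.mul_sum, ← Finset.sum_add_distrib]
    refine Finset.sum_congr rfl fun u _ => ?_
    rw [Finset.sum_comm, Finset.mul_sum, ← Finset.sum_add_distrib]
    refine Finset.sum_congr rfl fun v _ => ?_
    by_cases huv : u < v ∧ H.Adj u v
    · obtain ⟨hlt, hadj⟩ := huv
      simp only [hlt, hadj, true_and]
      convert sum_ite_eq_ite_add_mul_ite (fun j => u ∈ T j ∪ S ∧ v ∈ T j ∪ S) (u ∈ S ∧ v ∈ S)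
        (u ∈ Finset.univ ∧ v ∈ Finset.univ) (wE u v (a u) (a v)) ?_ ?_ ?_
      · rintro ⟨hu, hv⟩
        simp [hu, hv]
      · intro hS
        simp only [Finset.mem_univ, and_self, true_iff, Finset.mem_union]
        by_cases hu : u ∈ S
        · obtain ⟨j, hj⟩ := hmem v fun hv => hS ⟨hu, hv⟩
          exact ⟨j, Or.inr hu, Or.inl hj⟩
        · obtain ⟨i, hi⟩ := hmem u hu
          by_cases hv : v ∈ S
          · exact ⟨i, Or.inl hi, Or.inr hv⟩
          · obtain ⟨j, hj⟩ := hmem v hv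
            obtain rfl : i = j := by
              by_contra hij
              exact hsep i j hij u hi v hj hadj
            exact ⟨i, Or.inl hi, Or.inl hj⟩
      · simp only [Finset.mem_union]
        rintro hS i j ⟨hui, hvi⟩ ⟨huj, hvj⟩
        by_cases hu : u ∈ S
        · have hv : v ∉ S := fun hv => hS ⟨hu, hv⟩
          exact huniq v i j (hvi.resolve_right hv) (hvj.resolve_right hv)
        · exact huniq u i j (hui.resolve_right hu) (huj.resolve_right hu)
    · have hfalse : ∀ p : Prop, ¬ (u < v ∧ H.Adj u v ∧ p) := fun p h => huv ⟨h.1, h.2.1⟩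
      simp only [hfalse, if_false, Finset.sum_const_zero, mul_zero, add_zero]
  simp only [restrictedWeight, Finset.sum_add_distrib]
  rw [mul_add, add_add_add_comm, ← hnode]
  congr 1
end

section
/- Let H be a simple graph on Fin k with node weights wV and edge weights wE for the complete H-partite graph with parts of size n, and let (S, T₁, …, T_d) be a d-separator of H. Then there exists an H-subgraph of total weight 0 if and only if there exist an assignment s : S → Fin n and assignments a_j : T_j → Fin n for j = 1, …, d such that ∑_{j=1}^{d} w_{T_j ∪ S}(s ∪ a_j) = (d − 1)·w_S(s), where s ∪ a_j denotes any assignment of Fin k agreeing with s on S and with a_j on T_j (the quantity w_{T_j ∪ S} depends only on these values). -/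
theorem restrictedWeight_congr {k n : ℕ} (H : SimpleGraph (Fin k))
    (wV : Fin k → Fin n → ℤ) (wE : Fin k → Fin k → Fin n → Fin n → ℤ)
    {U : Finset (Fin k)} {a b : Fin k → Fin n} (h : ∀ i ∈ U, a i = b i) :
    restrictedWeight H wV wE U a = restrictedWeight H wV wE U b := by
  unfold restrictedWeight
  congr 1
  · exact Finset.sum_congr rfl fun i hi => by rw [h i hi]
  · refine Finset.sum_congr rfl fun i _ => Finset.sum_congr rfl fun j _ => ?_
    split_ifs with hij
    · rw [h i hij.2.2.1, h j hij.2.2.2]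
    · rfl

/-- A pair of elements not separated by `S` is contained in exactly one set `T j ∪ S`,
unless it lies in `S`, in which case it is contained in all of them. -/
theorem sum_ite_mem_separator {V : Type*} [DecidableEq V] {d : ℕ} {S : Finset V}
    {T : Fin d → Finset V} (hST : ∀ j, Disjoint S (T j))
    (hcover : ∀ v, v ∈ S ∨ ∃ j, v ∈ T j) {u v : V}
    (huv : ∀ i j, u ∈ T i → v ∈ T j → i = j)
    (hu : ∀ i j, u ∈ T i → u ∈ T j → i = j) (hv : ∀ i j, v ∈ T i → v ∈ T j → i = j) (c : ℤ) :
    (∑ j, if u ∈ T j ∪ S ∧ v ∈ T j ∪ S then c else 0) =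
      c + ((d : ℤ) - 1) * if u ∈ S ∧ v ∈ S then c else 0 := by
  have hd : ∀ w j, w ∈ T j → w ∉ S := fun w j hw hS =>
    Finset.disjoint_left.mp (hST j) hS hw
  by_cases hS : u ∈ S ∧ v ∈ S
  · simp [hS.1, hS.2]
    ring
  · obtain ⟨m, hm⟩ : ∃ m, ∀ j, (u ∈ T j ∪ S ∧ v ∈ T j ∪ S) ↔ j = m := by
      simp only [Finset.mem_union]
      rcases hcover u with h1 | ⟨m, h1⟩
      · rcases hcover v with h2 | ⟨m, h2⟩
        · exact absurd ⟨h1, h2⟩ hS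
        · have := hd v m h2
          exact ⟨m, fun j => by grind⟩
      · have := hd u m h1
        rcases hcover v with h2 | ⟨m', h2⟩
        · exact ⟨m, fun j => by grind⟩
        · have := hd v m' h2
          exact ⟨m, fun j => by grind⟩
    simp only [hm, hS, Finset.sum_ite_eq', Finset.mem_univ, if_true, if_false, mul_zero, add_zero]

theorem sum_restrictedWeight_separator {k n d : ℕ} (H : SimpleGraph (Fin k))
    (wV : Fin k → Fin n → ℤ) (wE : Fin k → Fin k → Fin n → Fin n → ℤ)
    {S : Finset (Fin k)} {T : Fin d → Finset (Fin k)}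
    (hTT : ∀ v i j, v ∈ T i → v ∈ T j → i = j)
    (hST : ∀ j, Disjoint S (T j))
    (hcover : ∀ v, v ∈ S ∨ ∃ j, v ∈ T j)
    (hsep : ∀ i j : Fin d, i ≠ j → ∀ u ∈ T i, ∀ v ∈ T j, ¬ H.Adj u v)
    (a : Fin k → Fin n) :
    ∑ j, restrictedWeight H wV wE (T j ∪ S) a =
      restrictedWeight H wV wE Finset.univ a +
        ((d : ℤ) - 1) * restrictedWeight H wV wE S a := by
  classical
  have hnode : ∑ j, ∑ i ∈ T j ∪ S, wV i (a i) =
      ∑ i, wV i (a i) + ((d : ℤ) - 1) * ∑ i ∈ S, wV i (a i) := by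
    have key := fun i => sum_ite_mem_separator hST hcover (hTT i) (hTT i) (hTT i) (wV i (a i))
    simp only [and_self] at key
    have hU : ∀ U : Finset (Fin k),
        ∑ i ∈ U, wV i (a i) = ∑ i, if i ∈ U then wV i (a i) else 0 := fun U => by simp
    rw [hU S, Finset.sum_congr rfl fun j _ => hU (T j ∪ S), Finset.sum_comm,
      Finset.mul_sum, ← Finset.sum_add_distrib]
    exact Finset.sum_congr rfl fun i _ => key i
  unfold restrictedWeight
  rw [Finset.sum_add_distrib, hnode, mul_add, add_add_add_comm]
  congr 1
  rw [Finset.sum_comm, Finset.mul_sum, ← Finset.sum_add_distrib]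
  refine Finset.sum_congr rfl fun u _ => ?_
  rw [Finset.sum_comm, Finset.mul_sum, ← Finset.sum_add_distrib]
  refine Finset.sum_congr rfl fun v _ => ?_
  by_cases huv : u < v ∧ H.Adj u v
  · have key := sum_ite_mem_separator hST hcover
      (fun i j hi hj => by_contra fun hij => hsep i j hij u hi v hj huv.2)
      (hTT u) (hTT v) (wE u v (a u) (a v))
    simpa only [huv.1, huv.2, true_and, Finset.mem_univ, and_self, if_true] using key
  · simp only [← and_assoc, huv, false_and, if_false, Finset.sum_const_zero, mul_zero, add_zero]

/- `(S, T 1, …, T d)` is a d-separator of `H`.  There is an H-subgraph of total weight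
`0` iff there are an assignment `s` on `S` and assignments `a j` on the `T j` (partial
assignments are represented by total functions; `a j` is required to agree with `s` on
`S`, so that `a j` plays the role of `s ∪ a_j`, and `w_{T j ∪ S}` only depends on these
values) with `∑ j, w_{T j ∪ S}(s ∪ a_j) = (d − 1)·w_S(s)`. -/
theorem stmt_8 (k n d : ℕ) (hk : 1 ≤ k) (hn : 1 ≤ n) (hd : 1 ≤ d)
    (H : SimpleGraph (Fin k))
    (wV : Fin k → Fin n → ℤ) (wE : Fin k → Fin k → Fin n → Fin n → ℤ)
    (S : Finset (Fin k)) (T : Fin d → Finset (Fin k))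
    (hTT : ∀ i j : Fin d, i ≠ j → Disjoint (T i) (T j))
    (hST : ∀ j : Fin d, Disjoint S (T j))
    (hcover : S ∪ Finset.univ.biUnion T = Finset.univ)
    (hsep : ∀ i j : Fin d, i ≠ j → ∀ u ∈ T i, ∀ v ∈ T j, ¬ H.Adj u v) :
    (∃ a : Fin k → Fin n, restrictedWeight H wV wE Finset.univ a = 0) ↔
      ∃ (s : Fin k → Fin n) (a : Fin d → Fin k → Fin n),
        (∀ j : Fin d, ∀ i ∈ S, a j i = s i) ∧
        (∑ j : Fin d, restrictedWeight H wV wE (T j ∪ S) (a j)) =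
          ((d : ℤ) - 1) * restrictedWeight H wV wE S s := by
  have hTT' : ∀ v i j, v ∈ T i → v ∈ T j → i = j := fun v i j hi hj =>
    by_contra fun hij => Finset.disjoint_left.mp (hTT i j hij) hi hj
  have hcover' : ∀ v, v ∈ S ∨ ∃ j, v ∈ T j := fun v => by
    have hv : v ∈ S ∪ Finset.univ.biUnion T := hcover ▸ Finset.mem_univ v
    simpa using hv
  have key := sum_restrictedWeight_separator H wV wE hTT' hST hcover' hsep
  constructor
  · rintro ⟨a, ha⟩
    exact ⟨a, fun _ => a, fun _ _ _ => rfl, by rw [key, ha, zero_add]⟩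
  · rintro ⟨s, a, has, hsum⟩
    classical
    let b : Fin k → Fin n := fun i => if h : ∃ j, i ∈ T j then a h.choose i else s i
    have hbS : ∀ i ∈ S, b i = s i := fun i hi =>
      dif_neg fun ⟨j, hj⟩ => Finset.disjoint_left.mp (hST j) hi hj
    have hbT : ∀ j, ∀ i ∈ T j, b i = a j i := fun j i hi => by
      have h : ∃ j, i ∈ T j := ⟨j, hi⟩
      simp only [b, dif_pos h, hTT' i _ _ h.choose_spec hi]
    have hbU : ∀ j, ∀ i ∈ T j ∪ S, a j i = b i := fun j i hi => by
      rcases Finset.mem_union.mp hi with h | h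
      · exact (hbT j i h).symm
      · rw [has j i h, hbS i h]
    refine ⟨b, ?_⟩
    rw [Finset.sum_congr rfl fun j _ => restrictedWeight_congr H wV wE (hbU j), key b,
      restrictedWeight_congr H wV wE hbS] at hsum
    linarith
end

section
/- Let H be a simple graph on Fin k with node weights wV and edge weights wE for the complete H-partite graph with parts of size n ≥ 1, and let (S, T₁, …, T_d) be a d-separator of H. Then the minimum total weight of an H-subgraph satisfies min_{a : Fin k → Fin n} w(a) = min_{s : S → Fin n} [ ∑_{j=1}^{d} ( min_{a_j : T_j → Fin n} w_{T_j ∪ S}(s ∪ a_j) ) − (d − 1)·w_S(s) ], where s ∪ a_j denotes any assignment of Fin k agreeing with s on S and with a_j on T_j. -/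
/-- If `P j` holds for all `j` when `Q` does, and for exactly one `j` otherwise, then counting `c`
once for each `P j` and subtracting the overcount `d - 1` when `Q` holds yields `c`. -/
theorem sum_ite_sub_overcount {d : ℕ} (P : Fin d → Prop) (Q : Prop)
    [DecidablePred P] [Decidable Q] (c : ℤ)
    (hQ : Q → ∀ j, P j) (hQ' : ¬ Q → ∃! j, P j) :
    (∑ j, if P j then c else 0) - ((d : ℤ) - 1) * (if Q then c else 0) = c := by
  by_cases h : Q
  · simp [h, hQ h]
    ring
  · obtain ⟨j, hj, huniq⟩ := hQ' h
    have hP : ∀ i, P i ↔ i = j := fun i => ⟨huniq i, fun hi => hi ▸ hj⟩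
    simp [h, hP]

/-- The total weight splits along a separator, by inclusion-exclusion. -/
theorem restrictedWeight_univ_eq_of_separator {k n d : ℕ} (H : SimpleGraph (Fin k))
    (wV : Fin k → Fin n → ℤ) (wE : Fin k → Fin k → Fin n → Fin n → ℤ)
    (S : Finset (Fin k)) (T : Fin d → Finset (Fin k))
    (hTT : ∀ i j : Fin d, i ≠ j → Disjoint (T i) (T j))
    (hcover : S ∪ Finset.univ.biUnion T = Finset.univ)
    (hsep : ∀ i j : Fin d, i ≠ j → ∀ u ∈ T i, ∀ v ∈ T j, ¬ H.Adj u v)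
    (a : Fin k → Fin n) :
    restrictedWeight H wV wE Finset.univ a =
      (∑ j, restrictedWeight H wV wE (T j ∪ S) a) -
        ((d : ℤ) - 1) * restrictedWeight H wV wE S a := by
  classical
  have hcov : ∀ i, i ∉ S → ∃ j, i ∈ T j := fun i hi => by
    have := Finset.mem_univ i
    rw [← hcover] at this
    simpa [hi] using this
  have huniq : ∀ {i : Fin k} {j j'}, i ∈ T j → i ∈ T j' → j = j' := fun {i j j'} h h' => by
    by_contra hne
    exact Finset.disjoint_left.mp (hTT j j' hne) h h'
  have hnode : ∀ i, (∑ j, if i ∈ T j ∪ S then wV i (a i) else 0) -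
      ((d : ℤ) - 1) * (if i ∈ S then wV i (a i) else 0) = wV i (a i) := fun i => by
    refine sum_ite_sub_overcount _ _ _ (fun h j => Finset.mem_union_right _ h) fun h => ?_
    obtain ⟨j, hj⟩ := hcov i h
    refine ⟨j, Finset.mem_union_left _ hj, fun j' hj' => ?_⟩
    exact huniq ((Finset.mem_union.mp hj').resolve_right h) hj
  have hedge : ∀ u v, (∑ j, if u < v ∧ H.Adj u v ∧ u ∈ T j ∪ S ∧ v ∈ T j ∪ S
        then wE u v (a u) (a v) else 0) -
      ((d : ℤ) - 1) * (if u < v ∧ H.Adj u v ∧ u ∈ S ∧ v ∈ S then wE u v (a u) (a v) else 0) =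
      if u < v ∧ H.Adj u v then wE u v (a u) (a v) else 0 := fun u v => by
    by_cases huv : u < v ∧ H.Adj u v
    · obtain ⟨hlt, hadj⟩ := huv
      simp only [hlt, hadj, true_and, and_self, if_true]
      have hmem : ∀ {x y : Fin k} {j}, H.Adj x y → x ∈ T j → y ∈ T j ∪ S := fun {x y j} hxy hx => by
        by_contra hy
        rw [Finset.mem_union, not_or] at hy
        obtain ⟨j', hj'⟩ := hcov y hy.2
        exact hsep j j' (fun h => hy.1 (h ▸ hj')) x hx y hj' hxy
      refine sum_ite_sub_overcount _ _ _
        (fun h j => ⟨Finset.mem_union_right _ h.1, Finset.mem_union_right _ h.2⟩) fun h => ?_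
      by_cases hu : u ∈ S
      · have hv : v ∉ S := fun hv => h ⟨hu, hv⟩
        obtain ⟨j, hj⟩ := hcov v hv
        exact ⟨j, ⟨hmem hadj.symm hj, Finset.mem_union_left _ hj⟩, fun j' hj' =>
          huniq ((Finset.mem_union.mp hj'.2).resolve_right hv) hj⟩
      · obtain ⟨j, hj⟩ := hcov u hu
        exact ⟨j, ⟨Finset.mem_union_left _ hj, hmem hadj hj⟩, fun j' hj' =>
          huniq ((Finset.mem_union.mp hj'.1).resolve_right hu) hj⟩
    · have : ∀ p : Prop, ¬ (u < v ∧ H.Adj u v ∧ p) := fun p h => huv ⟨h.1, h.2.1⟩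
      simp [huv, this]
  have hsum : ∀ U : Finset (Fin k), ∑ i ∈ U, wV i (a i) = ∑ i, if i ∈ U then wV i (a i) else 0 :=
    fun U => by simp
  have hnodes := Finset.sum_congr (rfl : (Finset.univ : Finset (Fin k)) = _) fun i _ => hnode i
  have hedges := Finset.sum_congr (rfl : (Finset.univ : Finset (Fin k)) = _) fun u _ =>
    Finset.sum_congr (rfl : (Finset.univ : Finset (Fin k)) = _) fun v _ => hedge u v
  simp only [Finset.sum_sub_distrib, ← Finset.mul_sum] at hnodes hedges
  rw [Finset.sum_comm] at hnodes
  simp only [Finset.sum_comm (s := Finset.univ (α := Fin k)) (t := Finset.univ (α := Fin d))]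
    at hedges
  unfold restrictedWeight
  simp only [Finset.mem_univ, and_true, Finset.sum_add_distrib, hsum (_ ∪ _), hsum S]
  linarith

/- `(S, T 1, …, T d)` is a d-separator of `H`.  The minimum total weight of an
H-subgraph equals the minimum over assignments `s` of
`∑ j (min over assignments `t` on `T j` of w_{T j ∪ S}(s ∪ t)) − (d−1)·w_S(s)`.
Partial assignments are represented by total functions; `fun i => if i ∈ T j then t i
else s i` is an assignment agreeing with `s` on `S` and with `t` on `T j`, and
`w_{T j ∪ S}` depends only on these values. -/
theorem stmt_9 (k n d : ℕ) (hk : 1 ≤ k) (hn : 1 ≤ n) (hd : 1 ≤ d)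
    (H : SimpleGraph (Fin k))
    (wV : Fin k → Fin n → ℤ) (wE : Fin k → Fin k → Fin n → Fin n → ℤ)
    (S : Finset (Fin k)) (T : Fin d → Finset (Fin k))
    (hTT : ∀ i j : Fin d, i ≠ j → Disjoint (T i) (T j))
    (hST : ∀ j : Fin d, Disjoint S (T j))
    (hcover : S ∪ Finset.univ.biUnion T = Finset.univ)
    (hsep : ∀ i j : Fin d, i ≠ j → ∀ u ∈ T i, ∀ v ∈ T j, ¬ H.Adj u v)
    (hne : (Finset.univ : Finset (Fin k → Fin n)).Nonempty) :
    Finset.univ.inf' hne (fun a => restrictedWeight H wV wE Finset.univ a) =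
      Finset.univ.inf' hne (fun s =>
        (∑ j : Fin d, Finset.univ.inf' hne (fun t =>
            restrictedWeight H wV wE (T j ∪ S) (fun i => if i ∈ T j then t i else s i))) -
          ((d : ℤ) - 1) * restrictedWeight H wV wE S s) := by
  classical
  have hsplit := restrictedWeight_univ_eq_of_separator H wV wE S T hTT hcover hsep
  apply le_antisymm
  · refine Finset.le_inf' _ _ fun s _ => ?_
    choose t _ ht using fun j => Finset.exists_mem_eq_inf' hne (fun t =>
      restrictedWeight H wV wE (T j ∪ S) (fun i => if i ∈ T j then t i else s i))
    let a : Fin k → Fin n := fun i => if h : ∃ j, i ∈ T j then t h.choose i else s i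
    have haT : ∀ j, ∀ i ∈ T j, a i = t j i := fun j i hi => by
      have h : ∃ j, i ∈ T j := ⟨j, hi⟩
      have hj : h.choose = j := by
        by_contra hne'
        exact Finset.disjoint_left.mp (hTT _ _ hne') h.choose_spec hi
      simp only [a, dif_pos h, hj]
    have haS : ∀ i ∈ S, a i = s i := fun i hi =>
      dif_neg fun ⟨j, hj⟩ => Finset.disjoint_left.mp (hST j) hi hj
    refine (Finset.inf'_le _ (Finset.mem_univ a)).trans_eq ?_
    rw [hsplit, restrictedWeight_congr H wV wE haS]
    congr 1
    refine Finset.sum_congr rfl fun j _ => ?_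
    rw [ht j]
    refine restrictedWeight_congr H wV wE fun i hi => ?_
    split_ifs with h
    · exact haT j i h
    · exact haS i ((Finset.mem_union.mp hi).resolve_left h)
  · refine Finset.le_inf' _ _ fun a _ => (Finset.inf'_le _ (Finset.mem_univ a)).trans ?_
    rw [hsplit]
    refine sub_le_sub_right (Finset.sum_le_sum fun j _ => ?_) _
    refine (Finset.inf'_le _ (Finset.mem_univ a)).trans_eq ?_
    simp
end
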